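/- There exists a constant C(p) > 0, depending only on p and independent of k and of the choices of the intervals I(J), such that for every subinterval I of [0,1): ⟨w_k⟩_I^{p−1}·⟨σ_k⟩_I ≤ C(p) and ⟨σ_k⟩_I^{p'−1}·⟨w_k⟩_I ≤ C(p), where p' := p/(p−1). -/

import Mathlib

open MeasureTheory Set Filter

noncomputable section

namespace RTpaper

/-- The half-open interval `[a, b)` represented by the pair `(a, b)`. -/
def ivSet (I : ℝ × ℝ) : Set ℝ := Set.Ico I.1 I.2

/-- The length of the interval represented by `I`. -/
def len (I : ℝ × ℝ) : ℝ := I.2 - I.1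

/-- The middle triadic child of an interval. -/
def mid (I : ℝ × ℝ) : ℝ × ℝ := (I.1 + (I.2 - I.1) / 3, I.2 - (I.2 - I.1) / 3)

/-- The families `𝐊ᵢ` of the Reguera–Thiele construction. -/
def Kfam (k : ℕ) : ℕ → Set (ℝ × ℝ)
  | 0 => {((0 : ℝ), (1 : ℝ))}
  | (i + 1) =>
      {I | ∃ K ∈ Kfam k i, ∃ j : ℕ, j < 3 ^ (k - 1) ∧
        I = ((mid K).1 + (j : ℝ) * ((3 : ℝ) ^ (1 - (k : ℤ)) * len (mid K)),
             (mid K).1 + ((j : ℝ) + 1) * ((3 : ℝ) ^ (1 - (k : ℤ)) * len (mid K)))}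

/-- The families `𝐉ᵢ` (of interest for `i ≥ 1`). -/
def Jfam (k i : ℕ) : Set (ℝ × ℝ) := {J | ∃ K ∈ Kfam k (i - 1), J = mid K}

/-- The family `𝐊 = ⋃ᵢ 𝐊ᵢ`. -/
def KK (k : ℕ) : Set (ℝ × ℝ) := ⋃ i, Kfam k i

/-- The family `𝐉 = ⋃_{i ≥ 1} 𝐉ᵢ`. -/
def JJ (k : ℕ) : Set (ℝ × ℝ) := ⋃ i, Jfam k (i + 1)

/-- The chosen triadic interval `I(J)` adjacent to `J` of length `3^{1-k}|J|`, encoded by a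
choice function `ch` deciding, for each `J`, whether `I(J)` lies to the right (`true`) or to
the left (`false`) of `J`. -/
def IJ (k : ℕ) (ch : ℝ × ℝ → Bool) (J : ℝ × ℝ) : ℝ × ℝ :=
  if ch J then (J.2, J.2 + (3 : ℝ) ^ (1 - (k : ℤ)) * len J)
  else (J.1 - (3 : ℝ) ^ (1 - (k : ℤ)) * len J, J.1)

/-- The weight `w_k = Σ_{i ≥ 1} Σ_{J ∈ 𝐉ᵢ} (3^k/(3^{k-1}+1))^i · 1_{I(J)}`. -/
def wgt (k : ℕ) (ch : ℝ × ℝ → Bool) (x : ℝ) : ℝ :=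
  ∑' i : ℕ, ∑' J : ↥(Jfam k (i + 1)),
    Set.indicator (ivSet (IJ k ch (J : ℝ × ℝ)))
      (fun _ => ((3 : ℝ) ^ k / ((3 : ℝ) ^ (k - 1) + 1)) ^ (i + 1)) x

/-- The weight `σ_k = w_k^{1-p}` on `{w_k > 0}`, and `0` elsewhere. -/
def sgm (p : ℝ) (k : ℕ) (ch : ℝ × ℝ → Bool) (x : ℝ) : ℝ :=
  if 0 < wgt k ch x then wgt k ch x ^ (1 - p) else 0

/-- `u(I) = ∫_I u`. -/
def mass (u : ℝ → ℝ) (I : ℝ × ℝ) : ℝ := ∫ x in ivSet I, u x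

/-- `⟨u⟩_I = u(I)/|I|`. -/
def avg (u : ℝ → ℝ) (I : ℝ × ℝ) : ℝ := mass u I / len I

/-- `ch_𝐊(K)`: the members of `𝐊_{i+1}` contained in `K ∈ 𝐊ᵢ`. -/
def chK (k : ℕ) (K : ℝ × ℝ) : Set (ℝ × ℝ) :=
  {K' | ∃ i, K ∈ Kfam k i ∧ K' ∈ Kfam k (i + 1) ∧ ivSet K' ⊆ ivSet K}

/-- Triadic intervals of `ℝ`. -/
def IsTriadic (I : ℝ × ℝ) : Prop :=
  ∃ n j : ℤ, I.1 = (j : ℝ) * (3 : ℝ) ^ (-n) ∧ I.2 = ((j : ℝ) + 1) * (3 : ℝ) ^ (-n)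

/-- Maximal members of `S` strictly contained in `R`. -/
def maxIn (S : Set (ℝ × ℝ)) (R : ℝ × ℝ) : Set (ℝ × ℝ) :=
  {Q | Q ∈ S ∧ ivSet Q ⊂ ivSet R ∧
    ∀ Q' ∈ S, ivSet Q ⊆ ivSet Q' → ivSet Q' ⊂ ivSet R → ivSet Q' = ivSet Q}

/-- Martingale `ε`-sparse families of (half-open) intervals. -/
def MSparse (ε : ℝ) (S : Set (ℝ × ℝ)) : Prop :=
  S.Countable ∧ (∀ I ∈ S, I.1 < I.2) ∧
    (∀ I ∈ S, ∀ J ∈ S, ivSet I ⊆ ivSet J ∨ ivSet J ⊆ ivSet I ∨ ivSet I ∩ ivSet J = ∅) ∧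
    ∀ R ∈ S, (∑' Q : ↥(maxIn S R), len (Q : ℝ × ℝ)) ≤ ε * len R

/-- `Σ_{I ∈ F} ⟨u⟩_I^q · ⟨v⟩_I · |I|`. -/
def sumTest (q : ℝ) (u v : ℝ → ℝ) (F : Set (ℝ × ℝ)) : ℝ :=
  ∑' I : ↥F, avg u (I : ℝ × ℝ) ^ q * avg v (I : ℝ × ℝ) * len (I : ℝ × ℝ)


/-- `3^{-k}`. -/
def qq (k : ℕ) : ℝ := ((3 : ℝ) ^ k)⁻¹

/-- The `j`-th child in the next family. -/
def kid (k : ℕ) (K : ℝ × ℝ) (j : ℕ) : ℝ × ℝ :=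
  (K.1 + len K / 3 + j * (qq k * len K), K.1 + len K / 3 + ((j : ℝ) + 1) * (qq k * len K))

lemma qq_pos (k : ℕ) : 0 < qq k := by unfold qq; positivity

lemma qq_le {k : ℕ} (hk : 3000 < k) : qq k ≤ 1 / 12 := by
  unfold qq
  rw [one_div]
  apply inv_anti₀ (by norm_num)
  calc (12 : ℝ) ≤ 3 ^ 3 := by norm_num
    _ ≤ 3 ^ k := pow_le_pow_right₀ (by norm_num) (by omega)

lemma N_qq {k : ℕ} (hk : 3000 < k) : (3 : ℝ) ^ (k - 1) * qq k = 1 / 3 := by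
  unfold qq
  obtain ⟨m, rfl⟩ : ∃ m, k = m + 1 := ⟨k - 1, by omega⟩
  have : (3 : ℝ) ^ m ≠ 0 := by positivity
  simp only [Nat.add_sub_cancel, pow_succ]
  field_simp

lemma scale (k : ℕ) (K : ℝ × ℝ) : (3 : ℝ) ^ (1 - (k : ℤ)) * len (mid K) = qq k * len K := by
  have : (3 : ℝ) ^ (1 - (k : ℤ)) = 3 * qq k := by
    rw [zpow_sub₀ (by norm_num)]; simp [qq, div_eq_mul_inv]
  rw [this]; simp only [len, mid]; ring

lemma mem_succ {k i : ℕ} {I : ℝ × ℝ} :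
    I ∈ Kfam k (i + 1) ↔ ∃ K ∈ Kfam k i, ∃ j : ℕ, j < 3 ^ (k - 1) ∧ I = kid k K j := by
  simp only [Kfam, Set.mem_setOf_eq, scale]
  rfl

lemma len_kid (k : ℕ) (K : ℝ × ℝ) (j : ℕ) : len (kid k K j) = qq k * len K := by
  simp only [len, kid]; ring

lemma len_K {k i : ℕ} {K : ℝ × ℝ} (h : K ∈ Kfam k i) : len K = qq k ^ i := by
  induction i generalizing K with
  | zero => simp only [Kfam, Set.mem_singleton_iff] at h; subst h; simp [len]
  | succ i ih =>
    obtain ⟨K', hK', j, hj, rfl⟩ := mem_succ.1 h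
    rw [len_kid, ih hK', pow_succ]; ring

lemma len_pos {k i : ℕ} {K : ℝ × ℝ} (h : K ∈ Kfam k i) : 0 < len K := by
  rw [len_K h]; exact pow_pos (qq_pos k) _

lemma mem_iv {K : ℝ × ℝ} {x : ℝ} : x ∈ ivSet K ↔ K.1 ≤ x ∧ x < K.2 := Iff.rfl

lemma mem_mid {K : ℝ × ℝ} {x : ℝ} :
    x ∈ ivSet (mid K) ↔ K.1 + len K / 3 ≤ x ∧ x < K.1 + 2 * len K / 3 := by
  simp only [mem_iv, mid, len]
  constructor <;> rintro ⟨h1, h2⟩ <;> constructor <;> linarith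

lemma kid_sub {k : ℕ} (hk : 3000 < k) {K : ℝ × ℝ} (hK : 0 < len K) {j : ℕ} (hj : j < 3 ^ (k - 1)) :
    ivSet (kid k K j) ⊆ ivSet (mid K) := by
  intro x hx
  have hq := mul_pos (qq_pos k) hK
  have hN := N_qq hk
  have hj' : (j : ℝ) + 1 ≤ 3 ^ (k - 1) := by exact_mod_cast hj
  have h2 : ((j : ℝ) + 1) * (qq k * len K) ≤ len K / 3 := by
    calc ((j : ℝ) + 1) * (qq k * len K) ≤ 3 ^ (k - 1) * (qq k * len K) := by gcongr
      _ = (3 ^ (k - 1) * qq k) * len K := by ring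
      _ = len K / 3 := by rw [hN]; ring
  have h3 : 0 ≤ (j : ℝ) * (qq k * len K) := by positivity
  rw [mem_mid]
  simp only [mem_iv, kid] at hx
  constructor <;> linarith [hx.1, hx.2]

lemma mid_sub {K : ℝ × ℝ} (hK : 0 < len K) : ivSet (mid K) ⊆ ivSet K := by
  intro x hx
  rw [mem_mid] at hx
  simp only [mem_iv, len] at *
  constructor <;> linarith [hx.1, hx.2]

lemma exists_kid {k : ℕ} (hk : 3000 < k) {K : ℝ × ℝ} (hK : 0 < len K) {x : ℝ}
    (hx : x ∈ ivSet (mid K)) : ∃ j < 3 ^ (k - 1), x ∈ ivSet (kid k K j) := by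
  have hq := mul_pos (qq_pos k) hK
  have hN := N_qq hk
  rw [mem_mid] at hx
  set y := (x - (K.1 + len K / 3)) / (qq k * len K) with hy
  have hyx : y * (qq k * len K) = x - (K.1 + len K / 3) := div_mul_cancel₀ _ hq.ne'
  have hy0 : 0 ≤ y := div_nonneg (by linarith [hx.1]) hq.le
  refine ⟨⌊y⌋₊, ?_, ?_⟩
  · rw [Nat.floor_lt hy0, hy, div_lt_iff₀ hq]
    push_cast
    have : (3 : ℝ) ^ (k - 1) * (qq k * len K) = len K / 3 := by rw [← mul_assoc, hN]; ring
    rw [this]; linarith [hx.2]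
  · have h1 := Nat.floor_le hy0
    have h2 := Nat.lt_floor_add_one y
    have h3 := mul_le_mul_of_nonneg_right h1 hq.le
    have h4 := mul_lt_mul_of_pos_right h2 hq
    rw [hyx] at h3 h4
    simp only [mem_iv, kid]
    constructor <;> linarith

lemma kid_unique {k : ℕ} {K : ℝ × ℝ} (hK : 0 < len K) {x : ℝ} {j j' : ℕ}
    (h : x ∈ ivSet (kid k K j)) (h' : x ∈ ivSet (kid k K j')) : j = j' := by
  have hq := mul_pos (qq_pos k) hK
  simp only [mem_iv, kid] at h h'
  have a : (j : ℝ) * (qq k * len K) < ((j' : ℝ) + 1) * (qq k * len K) := by linarith [h.1, h'.2]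
  have b : (j' : ℝ) * (qq k * len K) < ((j : ℝ) + 1) * (qq k * len K) := by linarith [h'.1, h.2]
  have a' := lt_of_mul_lt_mul_right a hq.le
  have b' := lt_of_mul_lt_mul_right b hq.le
  have a'' : j < j' + 1 := by exact_mod_cast a'
  have b'' : j' < j + 1 := by exact_mod_cast b'
  omega

lemma K_unique {k : ℕ} (hk : 3000 < k) {i : ℕ} {K K' : ℝ × ℝ} (h : K ∈ Kfam k i)
    (h' : K' ∈ Kfam k i) {x : ℝ} (hx : x ∈ ivSet K) (hx' : x ∈ ivSet K') : K = K' := by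
  induction i generalizing K K' with
  | zero =>
    simp only [Kfam, Set.mem_singleton_iff] at h h'
    rw [h, h']
  | succ i ih =>
    obtain ⟨L, hL, j, hj, rfl⟩ := mem_succ.1 h
    obtain ⟨L', hL', j', hj', rfl⟩ := mem_succ.1 h'
    have e : L = L' := ih hL hL' (mid_sub (len_pos hL) (kid_sub hk (len_pos hL) hj hx))
      (mid_sub (len_pos hL') (kid_sub hk (len_pos hL') hj' hx'))
    subst e
    have ej := kid_unique (len_pos hL) hx hx'
    rw [ej]

/-- The union of the family `Kfam k n`. -/
def UU (k n : ℕ) : Set ℝ := {x | ∃ K ∈ Kfam k n, x ∈ ivSet K}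

lemma UU_mid {k : ℕ} (hk : 3000 < k) {i m : ℕ} (him : i < m) {x : ℝ} (hx : x ∈ UU k m) :
    ∃ K ∈ Kfam k i, x ∈ ivSet (mid K) := by
  induction m with
  | zero => omega
  | succ m ih =>
    obtain ⟨K, hK, hxK⟩ := hx
    obtain ⟨L, hL, j, hj, rfl⟩ := mem_succ.1 hK
    have hm := kid_sub hk (len_pos hL) hj hxK
    rcases Nat.lt_succ_iff_lt_or_eq.1 him with h | rfl
    · exact ih h ⟨L, hL, mid_sub (len_pos hL) hm⟩
    · exact ⟨L, hL, hm⟩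

lemma not_UU {k : ℕ} (hk : 3000 < k) {i m : ℕ} (him : i < m) {K : ℝ × ℝ} (hK : K ∈ Kfam k i)
    {x : ℝ} (hx : x ∈ ivSet K) (hx' : x ∉ ivSet (mid K)) : x ∉ UU k m := by
  intro h
  obtain ⟨L, hL, hxL⟩ := UU_mid hk him h
  rw [K_unique hk hK hL hx (mid_sub (len_pos hL) hxL)] at hx'
  exact hx' hxL

lemma UU_anti {k : ℕ} (hk : 3000 < k) {i m : ℕ} (him : i ≤ m) : UU k m ⊆ UU k i := by
  rcases him.eq_or_lt with rfl | h
  · exact le_rfl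
  · intro x hx
    obtain ⟨L, hL, hxL⟩ := UU_mid hk h hx
    exact ⟨L, hL, mid_sub (len_pos hL) hxL⟩

lemma level_unique {k : ℕ} (hk : 3000 < k) {i m : ℕ} {K K' : ℝ × ℝ} (hK : K ∈ Kfam k i)
    (hK' : K' ∈ Kfam k m) {x : ℝ} (hx : x ∈ ivSet K) (hx' : x ∈ ivSet K')
    (hn : x ∉ ivSet (mid K)) (hn' : x ∉ ivSet (mid K')) : i = m := by
  rcases lt_trichotomy i m with h | h | h
  · exact absurd ⟨K', hK', hx'⟩ (not_UU hk h hK hx hn)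
  · exact h
  · exact absurd ⟨K, hK, hx⟩ (not_UU hk h hK' hx' hn')

lemma IJ_mem {k : ℕ} (hk : 3000 < k) (ch : ℝ × ℝ → Bool) {K : ℝ × ℝ} (hK : 0 < len K) {x : ℝ}
    (hx : x ∈ ivSet (IJ k ch (mid K))) :
    x ∉ ivSet (mid K) ∧ K.1 + len K / 4 ≤ x ∧ x < K.2 - len K / 4 := by
  have hq := mul_pos (qq_pos k) hK
  have hq' : qq k * len K ≤ 1 / 12 * len K := mul_le_mul_of_nonneg_right (qq_le hk) hK.le
  unfold IJ at hx
  rw [scale] at hx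
  rw [mem_mid]
  split_ifs at hx <;> simp only [mem_iv, mid] at hx <;> simp only [len] at * <;>
    refine ⟨fun h => ?_, ?_, ?_⟩ <;> linarith [hx.1, hx.2]

lemma IJ_sub {k : ℕ} (hk : 3000 < k) (ch : ℝ × ℝ → Bool) {K : ℝ × ℝ} (hK : 0 < len K) {x : ℝ}
    (hx : x ∈ ivSet (IJ k ch (mid K))) : x ∈ ivSet K := by
  have := IJ_mem hk ch hK hx
  constructor <;> linarith [this.2.1, this.2.2]

lemma vol_iv (K : ℝ × ℝ) : volume (ivSet K) = ENNReal.ofReal (len K) := Real.volume_Ico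

lemma vol_IJ (k : ℕ) (ch : ℝ × ℝ → Bool) (K : ℝ × ℝ) :
    volume (ivSet (IJ k ch (mid K))) = ENNReal.ofReal (qq k * len K) := by
  rw [vol_iv]
  congr 1
  unfold IJ
  rw [scale]
  split_ifs <;> simp only [len] <;> ring

lemma meas_iv (K : ℝ × ℝ) : MeasurableSet (ivSet K) := measurableSet_Ico

lemma Kfam_countable (k i : ℕ) : (Kfam k i).Countable := by
  induction i with
  | zero => simp [Kfam]
  | succ i ih =>
    have : Kfam k (i + 1) ⊆ ⋃ K ∈ Kfam k i, Set.range (kid k K) := by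
      intro I hI
      obtain ⟨K, hK, j, _, rfl⟩ := mem_succ.1 hI
      simp only [Set.mem_iUnion]
      exact ⟨K, hK, j, rfl⟩
    exact (Set.Countable.biUnion ih fun K _ => Set.countable_range _).mono this

lemma meas_UU (k n : ℕ) : MeasurableSet (UU k n) := by
  have : UU k n = ⋃ K ∈ Kfam k n, ivSet K := by ext x; simp [UU]
  rw [this]
  exact MeasurableSet.biUnion (Kfam_countable k n) fun K _ => meas_iv K

/-- Pointwise domination hypotheses. -/
structure Good (k : ℕ) (ch : ℝ × ℝ → Bool) (ρ : ℝ) (g : ℝ → ENNReal) : Prop where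
  le : ∀ i, ∀ K ∈ Kfam k i, ∀ x ∈ ivSet K, x ∉ ivSet (mid K) →
    g x ≤ Set.indicator (ivSet (IJ k ch (mid K))) (fun _ => ENNReal.ofReal (ρ ^ (i + 1))) x
  zero : ∀ x, (∀ n, x ∈ UU k n) → g x = 0

lemma split_le {k : ℕ} (hk : 3000 < k) {ch : ℝ × ℝ → Bool} {ρ : ℝ} {g : ℝ → ENNReal}
    (hg : Good k ch ρ g) {i : ℕ} {K : ℝ × ℝ} (hK : K ∈ Kfam k i) {A : Set ℝ}
    (hA : MeasurableSet A) (hAK : A ⊆ ivSet K) :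
    ∫⁻ x in A, g x ≤ ENNReal.ofReal (ρ ^ (i + 1)) * volume (A ∩ ivSet (IJ k ch (mid K))) +
      ∑ j : Fin (3 ^ (k - 1)), ∫⁻ x in A ∩ ivSet (kid k K j), g x := by
  set S := ivSet (IJ k ch (mid K)) with hS
  have hSm : MeasurableSet S := meas_iv _
  have hcov : A ⊆ ((A ∩ S) ∪ ((A \ ivSet (mid K)) \ S)) ∪
      ⋃ j : Fin (3 ^ (k - 1)), A ∩ ivSet (kid k K j) := by
    intro x hx
    by_cases h1 : x ∈ S
    · exact Or.inl (Or.inl ⟨hx, h1⟩)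
    by_cases h2 : x ∈ ivSet (mid K)
    · obtain ⟨j, hj, hxj⟩ := exists_kid hk (len_pos hK) h2
      exact Or.inr (Set.mem_iUnion.2 ⟨⟨j, hj⟩, hx, hxj⟩)
    · exact Or.inl (Or.inr ⟨⟨hx, h2⟩, h1⟩)
  refine (lintegral_mono_set hcov).trans ((lintegral_union_le _ _ _).trans ?_)
  refine add_le_add ((lintegral_union_le _ _ _).trans ?_) ?_
  · have hz : ∫⁻ x in (A \ ivSet (mid K)) \ S, g x = 0 := by
      refine setLIntegral_eq_zero ((hA.diff (meas_iv _)).diff hSm) ?_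
      intro x hx
      have := hg.le i K hK x (hAK hx.1.1) hx.1.2
      rw [Set.indicator_of_notMem hx.2] at this
      simpa using this
    rw [hz, add_zero, ← setLIntegral_const]
    refine setLIntegral_mono' (hA.inter hSm) ?_
    intro x hx
    have := hg.le i K hK x (hAK hx.1) (IJ_mem hk ch (len_pos hK) hx.2).1
    rwa [Set.indicator_of_mem hx.2] at this
  · refine (lintegral_iUnion_le _ _).trans ?_
    rw [tsum_fintype]

lemma trunc_le {k : ℕ} (hk : 3000 < k) {ch : ℝ × ℝ → Bool} {ρ : ℝ} {g : ℝ → ENNReal}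
    (hg : Good k ch ρ g) (hρ : 0 ≤ ρ) (hρ1 : ρ * (qq k * (3 ^ (k - 1) + 1)) ≤ 1) (d : ℕ) :
    ∀ i, ∀ K ∈ Kfam k i, ∫⁻ x in ivSet K \ UU k (i + d), g x ≤ ENNReal.ofReal (ρ ^ i * len K) := by
  induction d with
  | zero =>
    intro i K hK
    have : ivSet K \ UU k (i + 0) = ∅ := by
      rw [Set.diff_eq_empty]
      intro x hx
      exact ⟨K, hK, hx⟩
    rw [this]; simp
  | succ d ih =>
    intro i K hK
    have hl := len_pos hK
    have hq := qq_pos k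
    refine (split_le hk hg hK ((meas_iv K).diff (meas_UU k _)) Set.diff_subset).trans ?_
    have h1 : volume ((ivSet K \ UU k (i + (d + 1))) ∩ ivSet (IJ k ch (mid K))) ≤
        ENNReal.ofReal (qq k * len K) := by
      rw [← vol_IJ k ch K]
      exact measure_mono Set.inter_subset_right
    have h2 : ∀ j : Fin (3 ^ (k - 1)),
        ∫⁻ x in (ivSet K \ UU k (i + (d + 1))) ∩ ivSet (kid k K j), g x ≤
          ENNReal.ofReal (ρ ^ (i + 1) * (qq k * len K)) := by
      intro j
      rw [← len_kid k K j]
      refine le_trans (lintegral_mono_set ?_) (ih (i + 1) _ (mem_succ.2 ⟨K, hK, j, j.2, rfl⟩))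
      intro x hx
      refine ⟨hx.2, ?_⟩
      have := hx.1.2
      rwa [show i + (d + 1) = i + 1 + d by ring] at this
    calc _ ≤ ENNReal.ofReal (ρ ^ (i + 1)) * ENNReal.ofReal (qq k * len K) +
          ∑ j : Fin (3 ^ (k - 1)), ENNReal.ofReal (ρ ^ (i + 1) * (qq k * len K)) := by
            gcongr with j
            exact h2 j
      _ = ENNReal.ofReal (ρ ^ (i + 1) * (qq k * len K) +
            3 ^ (k - 1) * (ρ ^ (i + 1) * (qq k * len K))) := by
          rw [ENNReal.ofReal_add (by positivity) (by positivity),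
            ← ENNReal.ofReal_mul (by positivity)]
          congr 1
          rw [Finset.sum_const, Finset.card_univ, Fintype.card_fin, nsmul_eq_mul,
            ENNReal.ofReal_mul (p := 3 ^ (k - 1)) (by positivity)]
          congr 1
          rw [ENNReal.ofReal_pow (by norm_num)]
          push_cast
          norm_num
      _ ≤ _ := by
          apply ENNReal.ofReal_le_ofReal
          have : ρ ^ (i + 1) * (qq k * len K) + 3 ^ (k - 1) * (ρ ^ (i + 1) * (qq k * len K)) =
            (ρ * (qq k * (3 ^ (k - 1) + 1))) * (ρ ^ i * len K) := by ring
          rw [this]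
          exact mul_le_of_le_one_left (by positivity) hρ1

lemma K_le {k : ℕ} (hk : 3000 < k) {ch : ℝ × ℝ → Bool} {ρ : ℝ} {g : ℝ → ENNReal}
    (hg : Good k ch ρ g) (hρ : 0 ≤ ρ) (hρ1 : ρ * (qq k * (3 ^ (k - 1) + 1)) ≤ 1) 
    {i : ℕ} {K : ℝ × ℝ} (hK : K ∈ Kfam k i) :
    ∫⁻ x in ivSet K, g x ≤ ENNReal.ofReal (ρ ^ i * len K) := by
  have hcov : ivSet K ⊆ (⋂ n, UU k n) ∪ ⋃ d, ivSet K \ UU k (i + d) := by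
    intro x hx
    by_cases h : ∀ n, x ∈ UU k n
    · exact Or.inl (Set.mem_iInter.2 h)
    · push Not at h
      obtain ⟨n, hn⟩ := h
      refine Or.inr (Set.mem_iUnion.2 ⟨n, hx, fun h => hn (UU_anti hk (by omega) h)⟩)
  refine (lintegral_mono_set hcov).trans ((lintegral_union_le _ _ _).trans ?_)
  rw [setLIntegral_eq_zero (MeasurableSet.iInter fun n => meas_UU k n)
    (fun x hx => hg.zero x (Set.mem_iInter.1 hx)), zero_add, setLIntegral_iUnion_of_directed]
  · exact iSup_le fun d => trunc_le hk hg hρ hρ1 d i K hK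
  · apply Monotone.directed_le
    intro a b hab
    exact Set.diff_subset_diff_right (UU_anti hk (by omega))

/-- The child estimate for an interval not contained in the child. -/
lemma part_le {k : ℕ} (hk : 3000 < k) {ch : ℝ × ℝ → Bool} {ρ : ℝ} {g : ℝ → ENNReal}
    (hg : Good k ch ρ g) (hρ : 0 ≤ ρ) (hρ1 : ρ * (qq k * (3 ^ (k - 1) + 1)) ≤ 1) 
    {i : ℕ} {K : ℝ × ℝ} (hK : K ∈ Kfam k i) {I : ℝ × ℝ} (hI : ¬ (K.1 ≤ I.1 ∧ I.2 ≤ K.2)) :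
    ∫⁻ x in ivSet I ∩ ivSet K, g x ≤ ENNReal.ofReal (4 * ρ ^ i) * volume (ivSet I ∩ ivSet K) := by
  have hl := len_pos hK
  by_cases h : ∃ x ∈ ivSet I ∩ ivSet K, K.1 + len K / 4 ≤ x ∧ x < K.2 - len K / 4
  · obtain ⟨x, ⟨hxI, hxK⟩, hx1, hx2⟩ := h
    have hv : ENNReal.ofReal (len K / 4) ≤ volume (ivSet I ∩ ivSet K) := by
      rw [mem_iv] at hxI hxK
      by_cases h1 : K.1 ≤ I.1
      · have h2 : K.2 < I.2 := by
          by_contra h2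
          exact hI ⟨h1, not_lt.1 h2⟩
        calc ENNReal.ofReal (len K / 4) ≤ volume (Set.Ico x K.2) := by
              rw [Real.volume_Ico]; exact ENNReal.ofReal_le_ofReal (by linarith)
          _ ≤ _ := by
              apply measure_mono
              intro y hy
              rw [Set.mem_Ico] at hy
              refine ⟨⟨?_, ?_⟩, ?_, ?_⟩ <;> linarith [hy.1, hy.2, hxI.1, hxK.1]
      · push Not at h1
        calc ENNReal.ofReal (len K / 4) ≤ volume (Set.Ico K.1 x) := by
              rw [Real.volume_Ico]; exact ENNReal.ofReal_le_ofReal (by linarith)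
          _ ≤ _ := by
              apply measure_mono
              intro y hy
              rw [Set.mem_Ico] at hy
              refine ⟨⟨?_, ?_⟩, ?_, ?_⟩ <;> linarith [hy.1, hy.2, hxI.2, hxK.2]
    calc ∫⁻ x in ivSet I ∩ ivSet K, g x ≤ ∫⁻ x in ivSet K, g x :=
          lintegral_mono_set Set.inter_subset_right
      _ ≤ ENNReal.ofReal (ρ ^ i * len K) := K_le hk hg hρ hρ1 hK
      _ = ENNReal.ofReal (4 * ρ ^ i) * ENNReal.ofReal (len K / 4) := by
          rw [← ENNReal.ofReal_mul (by positivity)]; congr 1; ring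
      _ ≤ _ := by gcongr
  · push Not at h
    rw [setLIntegral_eq_zero ((meas_iv I).inter (meas_iv K))]
    · exact zero_le
    · intro x hx
      have hS : x ∉ ivSet (IJ k ch (mid K)) := fun hS => by
        have h1 := IJ_mem hk ch hl hS
        have h2 := h x hx h1.2.1
        linarith [h1.2.2]
      have hm : x ∉ ivSet (mid K) := fun hm => by
        rw [mem_mid] at hm
        have h2 := h x hx (by linarith [hm.1])
        have : len K = K.2 - K.1 := rfl
        linarith [hm.2]
      have := hg.le i K hK x hx.2 hm
      rw [Set.indicator_of_notMem hS] at this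
      simpa using this

lemma exists_level {k : ℕ} (hk : 3000 < k) {I : ℝ × ℝ} (h0 : 0 ≤ I.1) (h01 : I.1 < I.2)
    (h1 : I.2 ≤ 1) : ∃ i, (∃ K ∈ Kfam k i, K.1 ≤ I.1 ∧ I.2 ≤ K.2) ∧
      ∀ K ∈ Kfam k (i + 1), ¬ (K.1 ≤ I.1 ∧ I.2 ≤ K.2) := by
  by_contra hcon
  push Not at hcon
  have hall : ∀ i, ∃ K ∈ Kfam k i, K.1 ≤ I.1 ∧ I.2 ≤ K.2 := by
    intro i
    induction i with
    | zero => exact ⟨(0, 1), by simp [Kfam], h0, h1⟩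
    | succ i ih => exact hcon i ih
  obtain ⟨n, hn⟩ := exists_pow_lt_of_lt_one (sub_pos.2 h01)
    (show qq k < 1 by linarith [qq_le hk])
  obtain ⟨K, hK, ha, hb⟩ := hall n
  have := len_K hK
  unfold len at this
  linarith

lemma main_le {k : ℕ} (hk : 3000 < k) (ch : ℝ × ℝ → Bool) {I : ℝ × ℝ} (h0 : 0 ≤ I.1)
    (h01 : I.1 < I.2) (h1 : I.2 ≤ 1) : ∃ i : ℕ, ∀ ρ : ℝ, ∀ g : ℝ → ENNReal, Good k ch ρ g →
      0 ≤ ρ → ρ * (qq k * (3 ^ (k - 1) + 1)) ≤ 1 →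
      ∫⁻ x in ivSet I, g x ≤ ENNReal.ofReal (5 * ρ ^ i * len I) := by
  obtain ⟨i, ⟨K, hK, hIK⟩, hmax⟩ := exists_level hk h0 h01 h1
  refine ⟨i + 1, fun ρ g hg hρ hρ1 => ?_⟩
  have hl := len_pos hK
  have hIl : 0 < len I := sub_pos.2 h01
  have hsub : ivSet I ⊆ ivSet K := Set.Ico_subset_Ico hIK.1 hIK.2
  refine (split_le hk hg hK (meas_iv I) hsub).trans ?_
  have hsum : ∑ j : Fin (3 ^ (k - 1)), volume (ivSet I ∩ ivSet (kid k K j)) ≤ volume (ivSet I) := by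
    rw [← tsum_fintype (L := .unconditional _), ← measure_iUnion]
    · exact measure_mono (Set.iUnion_subset fun j => Set.inter_subset_left)
    · intro j j' hjj
      rw [Function.onFun, Set.disjoint_left]
      intro x hx hx'
      exact hjj (Fin.ext (kid_unique hl hx.2 hx'.2))
    · intro j
      exact (meas_iv I).inter (meas_iv _)
  calc _ ≤ ENNReal.ofReal (ρ ^ (i + 1)) * volume (ivSet I) +
        ∑ j : Fin (3 ^ (k - 1)), ENNReal.ofReal (4 * ρ ^ (i + 1)) *
          volume (ivSet I ∩ ivSet (kid k K j)) := by
        refine add_le_add (mul_le_mul_right (measure_mono Set.inter_subset_left) _) ?_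
        refine Finset.sum_le_sum fun j _ => ?_
        have hm : kid k K j ∈ Kfam k (i + 1) := mem_succ.2 ⟨K, hK, j, j.2, rfl⟩
        exact part_le hk hg hρ hρ1 hm (hmax _ hm)
    _ ≤ ENNReal.ofReal (ρ ^ (i + 1)) * volume (ivSet I) +
        ENNReal.ofReal (4 * ρ ^ (i + 1)) * volume (ivSet I) := by
        rw [← Finset.mul_sum]
        gcongr
    _ = _ := by
        rw [vol_iv, ← ENNReal.ofReal_mul (by positivity), ← ENNReal.ofReal_mul (by positivity),
          ← ENNReal.ofReal_add (by positivity) (by positivity)]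
        congr 1; ring

/-- The ratio. -/
def rr (k : ℕ) : ℝ := (3 : ℝ) ^ k / ((3 : ℝ) ^ (k - 1) + 1)

lemma rr_pos (k : ℕ) : 0 < rr k := by unfold rr; positivity

lemma one_le_rr {k : ℕ} (hk : 3000 < k) : 1 ≤ rr k := by
  unfold rr
  obtain ⟨m, rfl⟩ : ∃ m, k = m + 1 := ⟨k - 1, by omega⟩
  have : (1 : ℝ) ≤ 3 ^ m := one_le_pow₀ (by norm_num)
  rw [le_div_iff₀ (by positivity)]
  simp only [Nat.add_sub_cancel, pow_succ]
  linarith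

lemma rr_q (k : ℕ) : rr k * (qq k * (3 ^ (k - 1) + 1)) = 1 := by
  unfold rr qq
  field_simp

lemma wgt_zero {k : ℕ} (hk : 3000 < k) (ch : ℝ × ℝ → Bool) {x : ℝ} (hx : ∀ n, x ∈ UU k n) :
    wgt k ch x = 0 := by
  unfold wgt
  have : ∀ i : ℕ, ∑' J : ↥(Jfam k (i + 1)),
    Set.indicator (ivSet (IJ k ch (J : ℝ × ℝ)))
      (fun _ => ((3 : ℝ) ^ k / ((3 : ℝ) ^ (k - 1) + 1)) ^ (i + 1)) x = 0 := by
    intro i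
    have h : ∀ J : ↥(Jfam k (i + 1)), Set.indicator (ivSet (IJ k ch (J : ℝ × ℝ)))
      (fun _ => ((3 : ℝ) ^ k / ((3 : ℝ) ^ (k - 1) + 1)) ^ (i + 1)) x = 0 := by
      rintro ⟨J, K, hK, rfl⟩
      rw [Nat.add_sub_cancel] at hK
      apply Set.indicator_of_notMem
      intro h
      exact not_UU hk (Nat.lt_succ_self i) hK (IJ_sub hk ch (len_pos hK) h)
        (IJ_mem hk ch (len_pos hK) h).1 (hx _)
    simp only [h, tsum_zero]
  simp only [this, tsum_zero]

lemma wgt_eq {k : ℕ} (hk : 3000 < k) (ch : ℝ × ℝ → Bool) {i : ℕ} {K : ℝ × ℝ} (hK : K ∈ Kfam k i)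
    {x : ℝ} (hx : x ∈ ivSet K) (hn : x ∉ ivSet (mid K)) :
    wgt k ch x = Set.indicator (ivSet (IJ k ch (mid K))) (fun _ => rr k ^ (i + 1)) x := by
  unfold wgt
  rw [tsum_eq_single i]
  · rw [tsum_eq_single (⟨mid K, K, by simpa using hK, rfl⟩ : ↥(Jfam k (i + 1)))]
    · rfl
    · rintro ⟨J, K', hK', rfl⟩ hne
      rw [Nat.add_sub_cancel] at hK'
      apply Set.indicator_of_notMem
      intro h
      apply hne
      have := K_unique hk hK hK' hx (IJ_sub hk ch (len_pos hK') h)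
      subst this
      rfl
  · intro m hm
    have h : ∀ J : ↥(Jfam k (m + 1)), Set.indicator (ivSet (IJ k ch (J : ℝ × ℝ)))
      (fun _ => ((3 : ℝ) ^ k / ((3 : ℝ) ^ (k - 1) + 1)) ^ (m + 1)) x = 0 := by
      rintro ⟨J, K', hK', rfl⟩
      rw [Nat.add_sub_cancel] at hK'
      apply Set.indicator_of_notMem
      intro h
      exact hm (level_unique hk hK' hK (IJ_sub hk ch (len_pos hK') h) hx
        (IJ_mem hk ch (len_pos hK') h).1 hn)
    simp only [h, tsum_zero]

lemma wgt_nonneg (k : ℕ) (ch : ℝ × ℝ → Bool) (x : ℝ) : 0 ≤ wgt k ch x := by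
  unfold wgt
  refine tsum_nonneg fun i => tsum_nonneg fun J => Set.indicator_nonneg (fun _ _ => ?_) _
  positivity

lemma sgm_nonneg (p : ℝ) (k : ℕ) (ch : ℝ × ℝ → Bool) (x : ℝ) : 0 ≤ sgm p k ch x := by
  unfold sgm
  split_ifs with h
  · exact Real.rpow_nonneg h.le _
  · exact le_rfl

lemma good_wgt {k : ℕ} (hk : 3000 < k) (ch : ℝ × ℝ → Bool) :
    Good k ch (rr k) (fun x => ENNReal.ofReal (wgt k ch x)) where
  le i K hK x hx hn := by
    simp only [wgt_eq hk ch hK hx hn]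
    by_cases h : x ∈ ivSet (IJ k ch (mid K)) <;> simp [h]
  zero x hx := by simp [wgt_zero hk ch hx]

lemma good_sgm {k : ℕ} (hk : 3000 < k) (ch : ℝ × ℝ → Bool) (p : ℝ) :
    Good k ch (rr k ^ (1 - p)) (fun x => ENNReal.ofReal (sgm p k ch x)) where
  le i K hK x hx hn := by
    simp only [sgm, wgt_eq hk ch hK hx hn]
    by_cases h : x ∈ ivSet (IJ k ch (mid K))
    · simp only [h, Set.indicator_of_mem, pow_pos (rr_pos k), if_true]
      apply le_of_eq
      congr 1
      rw [← Real.rpow_natCast, ← Real.rpow_natCast, ← Real.rpow_mul (rr_pos k).le,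
        ← Real.rpow_mul (rr_pos k).le, mul_comm]
    · simp [h]
  zero x hx := by simp [sgm, wgt_zero hk ch hx]

lemma avg_le {u : ℝ → ℝ} (hu : ∀ x, 0 ≤ u x) {I : ℝ × ℝ} (hI : 0 < len I) {c : ℝ} (hc : 0 ≤ c)
    (h : ∫⁻ x in ivSet I, ENNReal.ofReal (u x) ≤ ENNReal.ofReal (c * len I)) : avg u I ≤ c := by
  unfold avg mass
  rw [div_le_iff₀ hI]
  have h1 := norm_integral_le_lintegral_norm (μ := volume.restrict (ivSet I)) u
  simp only [Real.norm_of_nonneg (hu _)] at h1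
  refine (le_abs_self _).trans (h1.trans ?_)
  exact ENNReal.toReal_le_of_le_ofReal (by positivity) h

lemma avg_nonneg {u : ℝ → ℝ} (hu : ∀ x, 0 ≤ u x) {I : ℝ × ℝ} (hI : 0 < len I) : 0 ≤ avg u I :=
  div_nonneg (integral_nonneg hu) hI.le

/-- Two-weight `A_p` estimate (Remark on `A_p`, eq. (3.1) of the paper): there is a constant
`C(p) > 0`, depending only on `p` and independent of `k` and of the choices of the intervals
`I(J)`, such that for every subinterval `I` of `[0,1)`,
`⟨w_k⟩_I^{p-1}·⟨σ_k⟩_I ≤ C(p)` and `⟨σ_k⟩_I^{p'-1}·⟨w_k⟩_I ≤ C(p)` where `p' = p/(p-1)`. -/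
theorem statement2 (p : ℝ) (hp : 1 < p) :
    ∃ C : ℝ, 0 < C ∧ ∀ k : ℕ, 3000 < k → ∀ ch : ℝ × ℝ → Bool,
      ∀ I : ℝ × ℝ, 0 ≤ I.1 → I.1 < I.2 → I.2 ≤ 1 →
        avg (wgt k ch) I ^ (p - 1) * avg (sgm p k ch) I ≤ C ∧
        avg (sgm p k ch) I ^ (p / (p - 1) - 1) * avg (wgt k ch) I ≤ C := by
  refine ⟨max (5 ^ p) ((5 ^ p) ^ (1 / (p - 1))), by positivity, ?_⟩
  intro k hk ch I h0 h01 h1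
  have hIl : 0 < len I := sub_pos.2 h01
  have hp1 : 0 < p - 1 := by linarith
  obtain ⟨i, hi⟩ := main_le hk ch h0 h01 h1
  have hr := rr_pos k
  have hR : 0 < rr k ^ i := pow_pos hr i
  have hw : avg (wgt k ch) I ≤ 5 * rr k ^ i :=
    avg_le (wgt_nonneg k ch) hIl (by positivity) (hi _ _ (good_wgt hk ch) hr.le (rr_q k).le)
  have hs : avg (sgm p k ch) I ≤ 5 * (rr k ^ (1 - p)) ^ i := by
    refine avg_le (sgm_nonneg p k ch) hIl (by positivity)
      (hi _ _ (good_sgm hk ch p) (by positivity) ?_)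
    have h2 : rr k ^ (1 - p) ≤ 1 := Real.rpow_le_one_of_one_le_of_nonpos (one_le_rr hk) (by linarith)
    have h3 : rr k ^ (1 - p) ≤ rr k := h2.trans (one_le_rr hk)
    have := qq_pos k
    calc _ ≤ rr k * (qq k * (3 ^ (k - 1) + 1)) := by gcongr
      _ ≤ 1 := (rr_q k).le
  have hw0 := avg_nonneg (wgt_nonneg k ch) hIl
  have hs0 := avg_nonneg (sgm_nonneg p k ch) hIl
  have hs' : (rr k ^ (1 - p)) ^ i = (rr k ^ i) ^ (1 - p) := by
    rw [← Real.rpow_natCast, ← Real.rpow_natCast, ← Real.rpow_mul hr.le,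
        ← Real.rpow_mul hr.le, mul_comm]
  rw [hs'] at hs
  have hA : avg (wgt k ch) I ^ (p - 1) * avg (sgm p k ch) I ≤ 5 ^ p := by
    calc _ ≤ (5 * rr k ^ i) ^ (p - 1) * (5 * (rr k ^ i) ^ (1 - p)) := by gcongr
      _ = (5 ^ (p - 1) * 5 ^ (1 : ℝ)) * ((rr k ^ i) ^ (p - 1) * (rr k ^ i) ^ (1 - p)) := by
          rw [Real.mul_rpow (by norm_num) hR.le, Real.rpow_one]; ring
      _ = 5 ^ p := by
          rw [← Real.rpow_add (by norm_num), ← Real.rpow_add hR]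
          simp
  refine ⟨hA.trans (le_max_left _ _), le_trans ?_ (le_max_right _ _)⟩
  have he : p / (p - 1) - 1 = 1 / (p - 1) := by field_simp; ring
  have hB : avg (sgm p k ch) I ^ (p / (p - 1) - 1) * avg (wgt k ch) I =
      (avg (wgt k ch) I ^ (p - 1) * avg (sgm p k ch) I) ^ (1 / (p - 1)) := by
    rw [he, Real.mul_rpow (by positivity) hs0, ← Real.rpow_mul hw0,
      mul_one_div_cancel hp1.ne', Real.rpow_one, mul_comm]
  rw [hB]
  exact Real.rpow_le_rpow (by positivity) hA (by positivity)

end RTpaper
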